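/- Let x, s, u ∈ ℂ be nonzero with x² ∉ {1, q², q⁻²}, and λ, ε ∈ ℝ. Writing f_x := f_{x,s,u,λ,ε}, for every z ∈ ℂ∖{0} at which all occurring functions are defined one has q^{−2ε}·f_x(z/q²) = A(x)·f_{q²x}(z) + B(x)·f_x(z) + A(x⁻¹)·f_{x/q²}(z), where A(x) := −x(1−sxq^{1−2iλ})(1−sxq^{1+2iλ})/(s(1−x²)(1−q²x²)) and B(x) := −A(x) − A(1/x). -/

import Mathlib

noncomputable section

open Complex

/-- `q^{iλ} := exp(iλ · log q)`. -/
def qil (q lam : ℝ) : ℂ := Complex.exp (Complex.I * lam * Real.log q)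

/-- the real power `q^a` viewed as a complex number. -/
def qr (q a : ℝ) : ℂ := ((q ^ a : ℝ) : ℂ)

/-- the infinite `q`-shifted factorial `(w;p)_∞ = ∏_{j≥0} (1 - w p^j)`. -/
def qPoch (w p : ℂ) : ℂ := ∏' j : ℕ, (1 - w * p ^ j)

/-- the theta function `θ(w;p) = (w;p)_∞ (p/w;p)_∞`. -/
def qTheta (w p : ℂ) : ℂ := qPoch w p * qPoch (p / w) p

/-- `μ_s = (s + s⁻¹)/(q⁻¹ - q)`. -/
def mu (q : ℝ) (s : ℂ) : ℂ := (s + s⁻¹) / ((q : ℂ)⁻¹ - (q : ℂ))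

/-- The eigenfunction
`f_{x,s,u,λ,ε}(z) = (sq^{1−2iλ}x^{±1}, uszq^{1+iλ};q²)_∞ θ(q^{2ε−iλ}uz/s;q²) /
(uzq^{−iλ}x^{±1}, sq^{1−iλ}/(uz);q²)_∞`. -/
def fAW (q lam eps : ℝ) (x s u : ℂ) (z : ℂ) : ℂ :=
  (qPoch (s * (q : ℂ) * ((qil q lam)⁻¹) ^ 2 * x) ((q : ℂ) ^ 2) *
    qPoch (s * (q : ℂ) * ((qil q lam)⁻¹) ^ 2 / x) ((q : ℂ) ^ 2) *
    qPoch (u * s * z * (q : ℂ) * qil q lam) ((q : ℂ) ^ 2) *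
    qTheta (qr q (2 * eps) * (qil q lam)⁻¹ * u * z / s) ((q : ℂ) ^ 2)) /
  (qPoch (u * z * (qil q lam)⁻¹ * x) ((q : ℂ) ^ 2) *
    qPoch (u * z * (qil q lam)⁻¹ / x) ((q : ℂ) ^ 2) *
    qPoch (s * (q : ℂ) * (qil q lam)⁻¹ / (u * z)) ((q : ℂ) ^ 2))

/-- the denominator of `f_{x,s,u,λ,ε}` at the point `z`. -/
def fDen (q lam : ℝ) (x s u : ℂ) (z : ℂ) : ℂ :=
  qPoch (u * z * (qil q lam)⁻¹ * x) ((q : ℂ) ^ 2) *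
    qPoch (u * z * (qil q lam)⁻¹ / x) ((q : ℂ) ^ 2) *
    qPoch (s * (q : ℂ) * (qil q lam)⁻¹ / (u * z)) ((q : ℂ) ^ 2)

/-- the coefficient `A(x) = −x(1−sxq^{1−2iλ})(1−sxq^{1+2iλ})/(s(1−x²)(1−q²x²))`. -/
def Acoef (q lam : ℝ) (s x : ℂ) : ℂ :=
  -(x * (1 - s * x * (q : ℂ) * ((qil q lam)⁻¹) ^ 2) * (1 - s * x * (q : ℂ) * (qil q lam) ^ 2)) /
    (s * (1 - x ^ 2) * (1 - (q : ℂ) ^ 2 * x ^ 2))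

/-- the coefficient `B(x) = −A(x) − A(1/x)`. -/
def Bcoef (q lam : ℝ) (s x : ℂ) : ℂ := -Acoef q lam s x - Acoef q lam s x⁻¹

lemma qPoch_step (w p : ℂ) (hp : ‖p‖ < 1) : qPoch w p = (1 - w) * qPoch (w * p) p := by
  have hs : Summable (fun j : ℕ => ‖-((w * p) * p ^ j)‖) := by
    have h0 : Summable (fun j : ℕ => ‖w * p‖ * ‖p‖ ^ j) :=
      (summable_geometric_of_lt_one (norm_nonneg _) hp).mul_left _
    refine h0.congr fun j => ?_
    rw [norm_neg, norm_mul (w * p), norm_pow]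
  have hm := multipliable_one_add_of_summable hs
  have he : (fun j : ℕ => 1 + -((w * p) * p ^ j)) = fun j : ℕ => 1 - w * p ^ (j + 1) := by
    funext j
    ring
  rw [he] at hm
  have h := tprod_eq_zero_mul' (f := fun j : ℕ => 1 - w * p ^ j) hm
  have e1 : qPoch w p = ∏' j : ℕ, (1 - w * p ^ j) := rfl
  have e2 : qPoch (w * p) p = ∏' j : ℕ, (1 - w * p ^ (j + 1)) := by
    rw [qPoch]
    refine tprod_congr fun j => ?_
    ring
  rw [e1, e2, h, pow_zero, mul_one]

lemma qPoch_div (w p : ℂ) (hp : ‖p‖ < 1) (hp0 : p ≠ 0) :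
    qPoch (w / p) p = (1 - w / p) * qPoch w p := by
  rw [qPoch_step (w / p) p hp, div_mul_cancel₀ _ hp0]

lemma qTheta_div (v p : ℂ) (hp : ‖p‖ < 1) (hp0 : p ≠ 0) (hv : v ≠ 0) :
    qTheta (v / p) p = -(v / p) * qTheta v p := by
  unfold qTheta
  rw [qPoch_div v p hp hp0, qPoch_step (p / v) p hp,
    show p / (v / p) = p / v * p by field_simp]
  field_simp
  ring

lemma core_rat (a b w x s Q : ℂ) (hx : x ≠ 0) (hs : s ≠ 0) (hw : w ≠ 0) (hQ : Q ≠ 0)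
    (h1 : 1 - x ^ 2 ≠ 0) (h2 : 1 - Q * x ^ 2 ≠ 0) (h3 : x ^ 2 - Q ≠ 0)
    (e1 : Q - w * x ≠ 0) (e2 : Q * x - w ≠ 0) :
    -(w / (s * Q)) * (1 - b * w / Q) * (1 - a / w) / ((1 - w * x / Q) * (1 - w / x / Q))
     = -(x * (1 - b * x)) / (s * (1 - x ^ 2) * (1 - Q * x ^ 2)) *
         ((1 - a / x / Q) * (1 - w * x) / (1 - w / x / Q) - (1 - a * x))
      + -(x⁻¹ * (1 - b * x⁻¹)) / (s * (1 - x⁻¹ ^ 2) * (1 - Q * x⁻¹ ^ 2)) *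
         ((1 - a * x / Q) * (1 - w / x) / (1 - w * x / Q) - (1 - a / x)) := by
  have i1 : -(x⁻¹ * (1 - b * x⁻¹)) / (s * (1 - x⁻¹ ^ 2) * (1 - Q * x⁻¹ ^ 2))
      = x ^ 2 * (x - b) / (s * (1 - x ^ 2) * (x ^ 2 - Q)) := by
    have h1' : x ^ 2 - 1 ≠ 0 := fun h => h1 (by linear_combination -h)
    field_simp
    ring
  have i2 : (1 - w * x / Q) = (Q - w * x) / Q := by field_simp
  have i3 : (1 - w / x / Q) = (Q * x - w) / (Q * x) := by field_simp
  rw [i1, i2, i3]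
  field_simp
  ring

/-- The action of `π_{λ,ε}(K⁻²)` on `f_x` as a `q²`-difference operator in `x`:
`q^{−2ε} f_x(z/q²) = A(x) f_{q²x}(z) + B(x) f_x(z) + A(x⁻¹) f_{x/q²}(z)`. -/
theorem stmt4 (q : ℝ) (hq0 : 0 < q) (hq1 : q < 1) (lam eps : ℝ) (x s u : ℂ)
    (hx : x ≠ 0) (hs : s ≠ 0) (hu : u ≠ 0)
    (hx2 : x ^ 2 ≠ 1) (hx2' : x ^ 2 ≠ (q : ℂ) ^ 2) (hx2'' : x ^ 2 ≠ ((q : ℂ) ^ 2)⁻¹)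
    (z : ℂ) (hz : z ≠ 0)
    (hd0 : fDen q lam x s u (z / (q : ℂ) ^ 2) ≠ 0)
    (hd1 : fDen q lam ((q : ℂ) ^ 2 * x) s u z ≠ 0)
    (hd2 : fDen q lam x s u z ≠ 0)
    (hd3 : fDen q lam (x / (q : ℂ) ^ 2) s u z ≠ 0) :
    qr q (-(2 * eps)) * fAW q lam eps x s u (z / (q : ℂ) ^ 2)
      = Acoef q lam s x * fAW q lam eps ((q : ℂ) ^ 2 * x) s u z
        + Bcoef q lam s x * fAW q lam eps x s u z
        + Acoef q lam s x⁻¹ * fAW q lam eps (x / (q : ℂ) ^ 2) s u z := by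
  have hqc : (q : ℂ) ≠ 0 := by exact_mod_cast hq0.ne'
  have hk : qil q lam ≠ 0 := Complex.exp_ne_zero _
  have hp : ‖(q : ℂ) ^ 2‖ < 1 := by
    rw [norm_pow, Complex.norm_real, Real.norm_of_nonneg hq0.le]
    exact pow_lt_one₀ hq0.le hq1 two_ne_zero
  have hc0 : qr q (2 * eps) ≠ 0 := by
    unfold qr
    exact_mod_cast (Real.rpow_pos_of_pos hq0 _).ne'
  have hc : qr q (-(2 * eps)) = (qr q (2 * eps))⁻¹ := by
    unfold qr
    rw [Real.rpow_neg hq0.le]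
    push_cast
    rfl
  rw [hc]
  unfold fDen at hd0 hd1 hd2 hd3
  unfold Bcoef fAW Acoef
  generalize qr q (2 * eps) = c at *
  generalize qil q lam = k at *
  have hQ : (q : ℂ) ^ 2 ≠ 0 := pow_ne_zero _ hqc
  obtain ⟨a, ha⟩ : ∃ a, a = s * (q : ℂ) * k⁻¹ ^ 2 := ⟨_, rfl⟩
  obtain ⟨b, hb⟩ : ∃ b, b = s * (q : ℂ) * k ^ 2 := ⟨_, rfl⟩
  obtain ⟨w, hw⟩ : ∃ w, w = u * z * k⁻¹ := ⟨_, rfl⟩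
  have hw0 : w ≠ 0 := by
    rw [hw]
    exact mul_ne_zero (mul_ne_zero hu hz) (inv_ne_zero hk)
  have r1 : s * (q : ℂ) * k⁻¹ / (u * z) = a / w := by
    rw [ha, hw]; field_simp
  have r2 : s * (q : ℂ) * k⁻¹ / (u * (z / (q : ℂ) ^ 2)) = a / w * (q : ℂ) ^ 2 := by
    rw [ha, hw]; field_simp
  have r3 : u * (z / (q : ℂ) ^ 2) * k⁻¹ = w / (q : ℂ) ^ 2 := by
    rw [hw]; ring
  have r4 : u * s * z * (q : ℂ) * k = b * w := by
    rw [hb, hw]; field_simp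
  have r5 : u * s * (z / (q : ℂ) ^ 2) * (q : ℂ) * k = b * w / (q : ℂ) ^ 2 := by
    rw [hb, hw]; field_simp
  have r6 : c * k⁻¹ * u * z / s = c * w / s := by
    rw [hw]; ring
  have r7 : c * k⁻¹ * u * (z / (q : ℂ) ^ 2) / s = c * w / s / (q : ℂ) ^ 2 := by
    rw [hw]; ring
  have r8 : ∀ y : ℂ, s * y * (q : ℂ) * k⁻¹ ^ 2 = a * y := fun y => by rw [ha]; ring
  have r9 : ∀ y : ℂ, s * y * (q : ℂ) * k ^ 2 = b * y := fun y => by rw [hb]; ring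
  simp only [r1, r2, r3, r4, r5, r6, r7, r8, r9, ← ha, ← hw] at hd0 hd1 hd2 hd3 ⊢
  clear r1 r2 r3 r4 r5 r6 r7 r8 r9 ha hb hw
  generalize (q : ℂ) ^ 2 = Q at *
  have g1 : ∀ y : ℂ, y * (Q * x) = y * x * Q := fun y => by ring
  have g2 : ∀ y : ℂ, y / (Q * x) = y / x / Q := fun y => by field_simp
  have g3 : ∀ y : ℂ, y * (x / Q) = y * x / Q := fun y => by ring
  have g4 : ∀ y : ℂ, y / (x / Q) = y / x * Q := fun y => by field_simp
  have g5 : w / Q * x = w * x / Q := by ring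
  have g6 : w / Q / x = w / x / Q := by ring
  have hv : c * w / s ≠ 0 := div_ne_zero (mul_ne_zero hc0 hw0) hs
  simp only [g1, g2, g3, g4, g5, g6] at hd0 hd1 hd2 hd3 ⊢
  rw [qTheta_div _ Q hp hQ hv]
  simp only [qPoch_div _ Q hp hQ] at hd0 hd1 hd2 hd3 ⊢
  rw [qPoch_step (a * x) Q hp, qPoch_step (a / x) Q hp, qPoch_step (w * x) Q hp,
    qPoch_step (w / x) Q hp, qPoch_step (a / w) Q hp]
  rw [qPoch_step (w * x) Q hp, qPoch_step (w / x) Q hp] at hd0 hd2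
  rw [qPoch_step (a / w) Q hp] at hd2
  generalize qPoch (a * x * Q) Q = X1 at *
  generalize qPoch (a / x * Q) Q = X2 at *
  generalize qPoch (w * x * Q) Q = Y1 at *
  generalize qPoch (w / x * Q) Q = Y2 at *
  generalize qPoch (a / w * Q) Q = Z at *
  generalize qPoch (b * w) Q = B at *
  generalize qTheta (c * w / s) Q = T at *
  clear hd1 hd3
  simp only [mul_ne_zero_iff] at hd0 hd2
  obtain ⟨⟨⟨n1, n2, n3⟩, n4, n5, n6⟩, n7⟩ := hd0
  obtain ⟨-, n8, -⟩ := hd2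
  have h1 : 1 - x ^ 2 ≠ 0 := fun h => hx2 (by linear_combination -h)
  have h2 : 1 - Q * x ^ 2 ≠ 0 := fun h => hx2'' (by
    field_simp; linear_combination -h)
  have h3 : x ^ 2 - Q ≠ 0 := fun h => hx2' (by linear_combination h)
  have e1 : Q - w * x ≠ 0 := fun h => n1 (by
    rw [← sub_eq_zero.mp h, div_self hQ, sub_self])
  have e2 : Q * x - w ≠ 0 := fun h => n4 (by
    rw [← sub_eq_zero.mp h]; field_simp; ring)
  have key := core_rat a b w x s Q hx hs hw0 hQ h1 h2 h3 e1 e2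
  have h1i : 1 - x⁻¹ ^ 2 ≠ 0 := fun h => h1 (by
    field_simp at h; linear_combination -h)
  have h2i : 1 - Q * x⁻¹ ^ 2 ≠ 0 := fun h => h3 (by
    field_simp at h; linear_combination h)
  have i0 : a * x⁻¹ = a / x := (div_eq_mul_inv a x).symm
  rw [i0]
  obtain ⟨α, hα⟩ : ∃ α, α = -(x * (1 - b * x)) / (s * (1 - x ^ 2) * (1 - Q * x ^ 2)) := ⟨_, rfl⟩
  obtain ⟨β, hβ⟩ : ∃ β, β = -(x⁻¹ * (1 - b * x⁻¹)) / (s * (1 - x⁻¹ ^ 2) * (1 - Q * x⁻¹ ^ 2)) :=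
    ⟨_, rfl⟩
  have j1 : -(x * (1 - a * x) * (1 - b * x)) / (s * (1 - x ^ 2) * (1 - Q * x ^ 2))
      = α * (1 - a * x) := by rw [hα]; ring
  have j2 : -(x⁻¹ * (1 - a / x) * (1 - b * x⁻¹)) / (s * (1 - x⁻¹ ^ 2) * (1 - Q * x⁻¹ ^ 2))
      = β * (1 - a / x) := by rw [hβ]; ring
  rw [j1, j2]
  rw [← hα, ← hβ] at key
  clear j1 j2 hα hβ
  -- common factor
  have key2 := congrArg (fun t => t * ((1 - a * x) * X1 * ((1 - a / x) * X2) * B * T /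
    ((1 - w * x) * Y1 * ((1 - w / x) * Y2) * ((1 - a / w) * Z)))) key
  beta_reduce at key2
  generalize 1 - a * x = A1 at *
  generalize 1 - a / x = A2 at *
  generalize 1 - a / w = A3 at *
  generalize 1 - w * x = W1 at *
  generalize 1 - w / x = W2 at *
  generalize 1 - w * x / Q = W3 at *
  generalize 1 - w / x / Q = W4 at *
  generalize 1 - a * x / Q = A4 at *
  generalize 1 - a / x / Q = A5 at *
  generalize 1 - b * w / Q = B1 at *
  clear key
  convert key2 using 1
  · field_simp
  · field_simp
    ring

end
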